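/- Let J₀(z) = (1/π)·∫₀^π cos(z·cos θ) dθ be the Bessel function of the first kind of order zero. Then for every λ ∈ ℝ, the improper integral ∫₀^∞ ((sin q − q·cos q)/q²)·J₀(λq) dq equals √(1 − λ²) if |λ| < 1, and equals 0 if |λ| ≥ 1. -/

import Mathlib

open Filter

noncomputable section

/-- The Bessel function of the first kind of order zero,
`J₀(z) = (1/π) ∫₀^π cos(z cos θ) dθ`. -/
def J0 (z : ℝ) : ℝ := (1 / Real.pi) * ∫ θ in (0:ℝ)..Real.pi, Real.cos (z * Real.cos θ)

lemma clog_avg_lt (w : ℂ) (hw : ‖w‖ < 1) :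
    ∫ θ in (0:ℝ)..2 * Real.pi, Real.cos θ * Real.log ‖1 - w * Complex.exp (θ * Complex.I)‖
      = - Real.pi * w.re := by
  have hslit : ∀ z : ℂ, ‖z‖ ≤ 1 → 1 - w * z ∈ Complex.slitPlane := by
    intro z hz
    left
    have h1 : (w * z).re ≤ ‖w * z‖ := Complex.re_le_norm _
    have h2 : ‖w * z‖ < 1 := by
      rw [norm_mul]
      nlinarith [norm_nonneg w, norm_nonneg z]
    simp only [Complex.sub_re, Complex.one_re]
    linarith
  have hd : ∀ z : ℂ, ‖z‖ ≤ 1 → HasDerivAt (fun z => (1 + z ^ 2) * Complex.log (1 - w * z))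
      ((2 * z) * Complex.log (1 - w * z) + (1 + z ^ 2) * (-w / (1 - w * z))) z := by
    intro z hz
    have h1 : HasDerivAt (fun z : ℂ => 1 - w * z) (-w) z := by
      simpa using ((hasDerivAt_id z).const_mul w).const_sub 1
    have h2 : HasDerivAt (fun z : ℂ => 1 + z ^ 2) (2 * z) z := by
      simpa using (hasDerivAt_pow 2 z).const_add 1
    exact h2.mul (h1.clog (hslit z hz))
  have hD : DifferentiableOn ℂ (fun z => (1 + z ^ 2) * Complex.log (1 - w * z))
      (Metric.closedBall 0 1) := by
    intro z hz
    exact (hd z (by simpa using hz)).differentiableAt.differentiableWithinAt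
  have key := hD.deriv_eq_smul_circleIntegral one_pos
  rw [(hd 0 (by simp)).deriv, circleIntegral] at key
  simp only [deriv_circleMap, circleMap_zero, smul_eq_mul] at key
  have e : ∀ θ : ℝ, ((1:ℝ):ℂ) * Complex.exp (θ * Complex.I) * Complex.I *
      (1 / (((1:ℝ):ℂ) * Complex.exp (θ * Complex.I) - 0) ^ 2 *
      ((1 + (((1:ℝ):ℂ) * Complex.exp (θ * Complex.I)) ^ 2) *
       Complex.log (1 - w * (((1:ℝ):ℂ) * Complex.exp (θ * Complex.I)))))
      = (2 * Complex.I) * (Complex.cos θ * Complex.log (1 - w * Complex.exp (θ * Complex.I))) := by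
    intro θ
    rw [Complex.cos, neg_mul, Complex.exp_neg]
    have := Complex.exp_ne_zero (θ * Complex.I)
    simp only [Complex.ofReal_one, one_mul, sub_zero]
    field_simp
    ring
  simp_rw [e] at key
  rw [intervalIntegral.integral_const_mul] at key
  have key2 : ∫ θ in (0:ℝ)..2 * Real.pi,
      Complex.cos θ * Complex.log (1 - w * Complex.exp (θ * Complex.I)) = - Real.pi * w := by
    apply mul_left_cancel₀ (show (2 * Complex.I) ≠ 0 by simp)
    rw [key]; simp; ring
  have hcont : Continuous (fun θ : ℝ =>
      Complex.cos θ * Complex.log (1 - w * Complex.exp (θ * Complex.I))) := by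
    apply Continuous.mul (by fun_prop)
    apply Continuous.clog (by fun_prop)
    intro θ
    exact hslit _ (by rw [Complex.norm_exp_ofReal_mul_I])
  have hre := congrArg Complex.reCLM key2
  rw [← ContinuousLinearMap.intervalIntegral_comp_comm _ (hcont.intervalIntegrable _ _)] at hre
  have e2 : ∀ θ : ℝ, Complex.reCLM (Complex.cos θ * Complex.log (1 - w * Complex.exp (θ * Complex.I)))
     = Real.cos θ * Real.log ‖1 - w * Complex.exp (θ * Complex.I)‖ := by
    intro θ
    rw [← Complex.ofReal_cos, Complex.reCLM_apply, Complex.re_ofReal_mul, Complex.log_re]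
  simp_rw [e2] at hre
  rw [hre]
  simp

lemma clog_int (w : ℂ) (a b : ℝ) : IntervalIntegrable
    (fun θ : ℝ => Real.log ‖1 - w * Complex.exp (θ * Complex.I)‖) MeasureTheory.volume a b := by
  apply MeromorphicOn.intervalIntegrable_log_norm (f := fun θ : ℝ => 1 - w * Complex.exp (θ * Complex.I))
  intro x _
  apply AnalyticAt.meromorphicAt
  apply AnalyticAt.sub analyticAt_const
  apply AnalyticAt.mul analyticAt_const
  exact AnalyticAt.comp (g := Complex.exp) (f := fun θ : ℝ => (θ : ℂ) * Complex.I)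
    (analyticAt_cexp.restrictScalars) ((Complex.ofRealCLM.analyticAt x).mul analyticAt_const)

lemma exp_ne_ae (w : ℂ) : ∀ᵐ θ : ℝ, 1 - w * Complex.exp (θ * Complex.I) ≠ 0 := by
  have h : {θ : ℝ | 1 - w * Complex.exp (θ * Complex.I) = 0}.Countable := by
    have h1 : (Complex.exp ⁻¹' {w⁻¹}).Countable :=
      Complex.countable_preimage_exp.2 (Set.countable_singleton _)
    have h2 := h1.preimage_of_injOn (f := fun θ : ℝ => (θ : ℂ) * Complex.I) (by
      intro a _ b _ hab
      simpa using hab)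
    refine h2.mono ?_
    intro θ hθ
    simp only [Set.mem_ofPred_eq] at hθ
    simp only [Set.mem_preimage, Set.mem_singleton_iff]
    exact eq_inv_of_mul_eq_one_right (sub_eq_zero.1 hθ).symm
  have := h.measure_zero MeasureTheory.volume
  rw [MeasureTheory.ae_iff]
  simpa using this

lemma clog_avg (w : ℂ) (hw : ‖w‖ ≤ 1) :
    ∫ θ in (0:ℝ)..2 * Real.pi, Real.cos θ * Real.log ‖1 - w * Complex.exp (θ * Complex.I)‖
      = - Real.pi * w.re := by
  have hlim : Tendsto (fun r : ℝ => ∫ θ in (0:ℝ)..2 * Real.pi,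
      Real.cos θ * Real.log ‖1 - ((r : ℂ) * w) * Complex.exp (θ * Complex.I)‖)
      (nhdsWithin 1 (Set.Ioo 0 1)) (nhds (∫ θ in (0:ℝ)..2 * Real.pi,
      Real.cos θ * Real.log ‖1 - w * Complex.exp (θ * Complex.I)‖)) := by
    apply intervalIntegral.tendsto_integral_filter_of_dominated_convergence
      (fun θ => Real.log 2 + |Real.log ‖1 - w * Complex.exp (θ * Complex.I)‖|)
    · refine Eventually.of_forall fun r => Measurable.aestronglyMeasurable ?_
      fun_prop
    · filter_upwards [self_mem_nhdsWithin] with r hr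
      filter_upwards [exp_ne_ae w] with θ hθ _
      rw [norm_mul]
      have h1 : ‖Real.cos θ‖ ≤ 1 := Real.abs_cos_le_one θ
      set u := w * Complex.exp (θ * Complex.I) with hu
      have hun : ‖u‖ ≤ 1 := by
        rw [hu, norm_mul, Complex.norm_exp_ofReal_mul_I, mul_one]; exact hw
      have hr0 : ‖(r : ℂ)‖ = r := by rw [Complex.norm_real, Real.norm_of_nonneg hr.1.le]
      have hrun : ‖(r:ℂ) * u‖ ≤ r := by
        rw [norm_mul, hr0]; nlinarith [hr.1]
      have hup : ‖1 - (r:ℂ) * u‖ ≤ 2 := by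
        refine (norm_sub_le _ _).trans ?_
        rw [norm_one]; linarith [hr.2]
      have hlo : 1 - r ≤ ‖1 - (r:ℂ) * u‖ := by
        have := norm_sub_norm_le (1:ℂ) ((r:ℂ) * u)
        rw [norm_one] at this; linarith
      have hlo2 : ‖1 - u‖ ≤ 2 * ‖1 - (r:ℂ) * u‖ := by
        have e : 1 - u = (1 - (r:ℂ) * u) - ((1 - r : ℝ) : ℂ) * u := by push_cast; ring
        rw [e]
        refine (norm_sub_le _ _).trans ?_
        rw [norm_mul, Complex.norm_real, Real.norm_of_nonneg (by linarith [hr.2])]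
        nlinarith [hr.2]
      have hpos : 0 < ‖1 - u‖ := norm_pos_iff.2 hθ
      have hpos2 : 0 < ‖1 - (r:ℂ) * u‖ := by linarith
      have h2 := Real.log_le_log hpos2 hup
      have h3 := Real.log_le_log hpos hlo2
      rw [Real.log_mul (by norm_num) hpos2.ne'] at h3
      rw [mul_assoc, ← hu]
      have h4 : ‖Real.log ‖1 - (r:ℂ) * u‖‖ ≤ Real.log 2 + |Real.log ‖1 - u‖| := by
        rw [Real.norm_eq_abs, abs_le]
        constructor
        · linarith [neg_abs_le (Real.log ‖1 - u‖)]
        · linarith [abs_nonneg (Real.log ‖1 - u‖)]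
      nlinarith [norm_nonneg (Real.log ‖1 - (r:ℂ) * u‖), norm_nonneg (Real.cos θ)]
    · exact intervalIntegrable_const.add (clog_int w _ _).abs
    · filter_upwards [exp_ne_ae w] with θ hθ _
      apply Tendsto.mono_left _ nhdsWithin_le_nhds
      have : ContinuousAt (fun r : ℝ => Real.cos θ * Real.log ‖1 - ((r : ℂ) * w) * Complex.exp (θ * Complex.I)‖) 1 := by
        apply ContinuousAt.mul continuousAt_const
        apply ContinuousAt.log (by fun_prop)
        simpa using hθ
      simpa [ContinuousAt] using this
  have hlim2 : Tendsto (fun r : ℝ => - Real.pi * ((r : ℂ) * w).re)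
      (nhdsWithin 1 (Set.Ioo 0 1)) (nhds (- Real.pi * w.re)) := by
    apply Tendsto.mono_left _ nhdsWithin_le_nhds
    have : ContinuousAt (fun r : ℝ => - Real.pi * ((r : ℂ) * w).re) 1 := by fun_prop
    simpa [ContinuousAt] using this
  have hne : (nhdsWithin (1:ℝ) (Set.Ioo 0 1)).NeBot := right_nhdsWithin_Ioo_neBot one_pos
  refine tendsto_nhds_unique hlim (hlim2.congr' ?_)
  filter_upwards [self_mem_nhdsWithin] with r hr
  rw [clog_avg_lt]
  rw [norm_mul, Complex.norm_real, Real.norm_of_nonneg hr.1.le]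
  nlinarith [hr.1, hr.2, norm_nonneg w]
lemma log_cos_gen (l c : ℝ) (w : ℂ) (hw : ‖w‖ ≤ 1) (hc : 0 < c)
    (h : ∀ θ : ℝ, |1 + l * Real.cos θ| = c * (‖1 - w * Complex.exp (θ * Complex.I)‖ *
      ‖1 - (starRingEnd ℂ w) * Complex.exp (θ * Complex.I)‖)) :
    ∫ θ in (0:ℝ)..Real.pi, Real.cos θ * Real.log |1 + l * Real.cos θ| = - Real.pi * w.re := by
  have hI : ∀ w : ℂ, ∀ a b : ℝ, IntervalIntegrable (fun θ : ℝ => Real.cos θ *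
      Real.log ‖1 - w * Complex.exp (θ * Complex.I)‖) MeasureTheory.volume a b := fun w a b =>
    (clog_int w a b).continuousOn_mul (by fun_prop)
  have hC : ∀ a b : ℝ, IntervalIntegrable (fun θ : ℝ => Real.cos θ *
      Real.log c) MeasureTheory.volume a b := fun a b =>
    (Continuous.intervalIntegrable (by fun_prop) _ _)
  have hae : ∀ᵐ θ : ℝ, Real.cos θ * Real.log |1 + l * Real.cos θ| = Real.cos θ * Real.log c +
      (Real.cos θ * Real.log ‖1 - w * Complex.exp (θ * Complex.I)‖ +
      Real.cos θ * Real.log ‖1 - (starRingEnd ℂ w) * Complex.exp (θ * Complex.I)‖) := by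
    filter_upwards [exp_ne_ae w, exp_ne_ae (starRingEnd ℂ w)] with θ h1 h2
    rw [h, Real.log_mul hc.ne' (mul_ne_zero (norm_ne_zero_iff.2 h1) (norm_ne_zero_iff.2 h2)),
      Real.log_mul (norm_ne_zero_iff.2 h1) (norm_ne_zero_iff.2 h2)]
    ring
  have hint : ∀ a b : ℝ, IntervalIntegrable (fun θ : ℝ => Real.cos θ *
      Real.log |1 + l * Real.cos θ|) MeasureTheory.volume a b := by
    intro a b
    refine ((hC a b).add ((hI w a b).add (hI (starRingEnd ℂ w) a b))).congr_ae ?_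
    refine MeasureTheory.ae_restrict_of_ae ?_
    filter_upwards [hae] with θ hθ
    rw [hθ]
  have h2pi : ∫ θ in (0:ℝ)..2 * Real.pi, Real.cos θ * Real.log |1 + l * Real.cos θ|
      = - (2 * Real.pi) * w.re := by
    rw [intervalIntegral.integral_congr_ae (hae.mono fun θ hθ _ => hθ),
      intervalIntegral.integral_add (hC _ _) ((hI w _ _).add (hI _ _ _)),
      intervalIntegral.integral_add (hI w _ _) (hI _ _ _), clog_avg w hw,
      clog_avg _ (by simpa using hw)]
    simp
    ring
  rw [← intervalIntegral.integral_add_adjacent_intervals (hint 0 Real.pi) (hint _ _)] at h2pi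
  have hs := intervalIntegral.integral_comp_sub_left (a := 0) (b := Real.pi)
    (fun θ => Real.cos θ * Real.log |1 + l * Real.cos θ|) (2 * Real.pi)
  simp only [Real.cos_two_pi_sub] at hs
  rw [show 2 * Real.pi - Real.pi = Real.pi by ring, sub_zero] at hs
  rw [← hs] at h2pi
  linarith

lemma norm_sq_aux (w : ℂ) (θ : ℝ) : ‖1 - w * Complex.exp (θ * Complex.I)‖ ^ 2 =
    (1 - (w.re * Real.cos θ - w.im * Real.sin θ)) ^ 2 +
      (w.re * Real.sin θ + w.im * Real.cos θ) ^ 2 := by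
  rw [← Complex.normSq_eq_norm_sq, Complex.normSq_apply]
  simp [Complex.exp_ofReal_mul_I_re, Complex.exp_ofReal_mul_I_im]
  ring

lemma log_cos_int (l : ℝ) :
    1 - (1 / Real.pi) * ∫ θ in (0:ℝ)..Real.pi, l * Real.cos θ * Real.log |1 + l * Real.cos θ| =
      if |l| < 1 then Real.sqrt (1 - l ^ 2) else 0 := by
  have hpi := Real.pi_pos
  have main : ∀ (c : ℝ) (w : ℂ), ‖w‖ ≤ 1 → 0 < c →
    (∀ θ : ℝ, |1 + l * Real.cos θ| = c * (‖1 - w * Complex.exp (θ * Complex.I)‖ *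
      ‖1 - (starRingEnd ℂ w) * Complex.exp (θ * Complex.I)‖)) →
    1 - (1 / Real.pi) * ∫ θ in (0:ℝ)..Real.pi, l * Real.cos θ * Real.log |1 + l * Real.cos θ|
      = 1 + l * w.re := by
    intro c w hw hc h
    simp_rw [mul_assoc l]
    rw [intervalIntegral.integral_const_mul, log_cos_gen l c w hw hc h]
    field_simp
    ring
  split_ifs with hl
  · set s := Real.sqrt (1 - l ^ 2) with hs
    have hl2 : l ^ 2 < 1 := by rw [← sq_abs]; nlinarith [abs_nonneg l]
    have hs0 : 0 ≤ s := Real.sqrt_nonneg _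
    have hss : s ^ 2 = 1 - l ^ 2 := Real.sq_sqrt (by linarith)
    have hs1 : (1 + s) ≠ 0 := by linarith
    rw [main ((1 + s) / 2) ((-(l / (1 + s)) : ℝ) : ℂ)]
    · rw [Complex.ofReal_re]; field_simp; nlinarith
    · rw [Complex.norm_real, norm_neg, Real.norm_eq_abs, abs_div, abs_of_pos (show 0 < 1 + s by linarith),
        div_le_one (by linarith)]
      linarith
    · linarith
    · intro θ
      have hb : 0 ≤ 1 + l * Real.cos θ := by
        have := Real.abs_cos_le_one θ
        have h2 : |l * Real.cos θ| ≤ 1 := by rw [abs_mul]; nlinarith [abs_nonneg l, abs_nonneg (Real.cos θ)]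
        linarith [neg_abs_le (l * Real.cos θ)]
      rw [Complex.conj_ofReal, ← sq, norm_sq_aux, abs_of_nonneg hb, Complex.ofReal_re, Complex.ofReal_im]
      have hsc := Real.sin_sq_add_cos_sq θ
      have hsin : Real.sin θ ^ 2 = 1 - Real.cos θ ^ 2 := by linarith
      have hl' : l ^ 2 = (1 - s) * (1 + s) := by linarith
      have e : (1 - (-(l / (1 + s)) * Real.cos θ - 0 * Real.sin θ)) ^ 2 +
        (-(l / (1 + s)) * Real.sin θ + 0 * Real.cos θ) ^ 2 = 1 + 2 * (l / (1 + s)) * Real.cos θ + l ^ 2 / (1 + s) ^ 2 := by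
        have : (-(l / (1 + s)) * Real.sin θ + 0 * Real.cos θ) ^ 2 = (l / (1+s)) ^ 2 * Real.sin θ ^ 2 := by ring
        rw [this, hsin, ← div_pow]; ring
      rw [e, hl']
      field_simp
      ring
  · push Not at hl
    have hl0 : l ≠ 0 := by rintro rfl; norm_num at hl
    have hl2 : 1 ≤ l ^ 2 := by rw [← sq_abs]; nlinarith
    have hm : 0 ≤ 1 - (1 / l) ^ 2 := by
      rw [div_pow, one_pow, sub_nonneg, div_le_one (by linarith)]; exact hl2
    set m := Real.sqrt (1 - (1 / l) ^ 2) with hmm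
    have hmsq : m ^ 2 = 1 - (1 / l) ^ 2 := Real.sq_sqrt hm
    rw [main (|l| / 2) ⟨-(1 / l), m⟩]
    · field_simp; norm_num
    · rw [← sq_le_one_iff₀ (norm_nonneg _), ← Complex.normSq_eq_norm_sq, Complex.normSq_apply]
      simp only; nlinarith
    · linarith
    · intro θ
      rw [← sq_eq_sq₀ (abs_nonneg _) (by positivity), mul_pow, mul_pow, norm_sq_aux, norm_sq_aux, sq_abs,
        div_pow, sq_abs]
      simp only [Complex.conj_re, Complex.conj_im]
      have hsc := Real.sin_sq_add_cos_sq θ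
      have hsin : Real.sin θ ^ 2 = 1 - Real.cos θ ^ 2 := by linarith
      have e : ∀ n : ℝ, n ^ 2 = 1 - (1 / l) ^ 2 → (1 - (-(1 / l) * Real.cos θ - n * Real.sin θ)) ^ 2 +
        (-(1 / l) * Real.sin θ + n * Real.cos θ) ^ 2 = 2 + 2 / l * Real.cos θ + 2 * n * Real.sin θ := by
        intro n hn
        linear_combination (hn) + ((1/l)^2 + n ^ 2) * hsc
      rw [e m hmsq, e (-m) (by rw [neg_sq, hmsq])]
      have e2 : (2 + 2 / l * Real.cos θ + 2 * m * Real.sin θ) * (2 + 2 / l * Real.cos θ + 2 * -m * Real.sin θ)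
         = (2 + 2 / l * Real.cos θ) ^ 2 - 4 * m ^ 2 * Real.sin θ ^ 2 := by ring
      rw [e2, hmsq, hsin]
      field_simp
      ring
/-- The entire cosine integral `∫₀ˣ (1 - cos t)/t dt`. -/
def Cin (x : ℝ) : ℝ := ∫ t in (0:ℝ)..x, Real.sin (t / 2) * Real.sinc (t / 2)

lemma cin_integrand_cont : Continuous (fun t : ℝ => Real.sin (t / 2) * Real.sinc (t / 2)) :=
  (by fun_prop : Continuous fun t : ℝ => Real.sin (t / 2)).mul
    (Real.continuous_sinc.comp (by fun_prop))

lemma cin_integrand_eq (t : ℝ) (ht : t ≠ 0) :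
    Real.sin (t / 2) * Real.sinc (t / 2) = (1 - Real.cos t) / t := by
  rw [Real.sinc_of_ne_zero (by positivity)]
  have h : Real.cos t = 1 - 2 * Real.sin (t / 2) ^ 2 := by
    have := Real.cos_two_mul (t / 2)
    rw [show 2 * (t / 2) = t by ring] at this
    have h2 := Real.sin_sq_add_cos_sq (t / 2)
    linarith
  rw [h]
  field_simp
  ring

lemma cin_cont : Continuous Cin :=
  intervalIntegral.continuous_primitive (fun a b => cin_integrand_cont.intervalIntegrable a b) 0

lemma cin_neg (x : ℝ) : Cin (-x) = Cin x := by
  unfold Cin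
  have := intervalIntegral.integral_comp_neg (a := 0) (b := x)
    (fun t : ℝ => Real.sin (t / 2) * Real.sinc (t / 2))
  simp only [neg_div, Real.sin_neg, Real.sinc_neg, neg_mul, intervalIntegral.integral_neg, neg_zero] at this
  rw [intervalIntegral.integral_symm, ← this, neg_neg]

lemma cin_abs (x : ℝ) : Cin |x| = Cin x := by
  rcases abs_choice x with h | h <;> rw [h]
  exact cin_neg x

lemma cin_small (x : ℝ) (h0 : 0 ≤ x) (h1 : x ≤ 1) : |Cin x| ≤ 1 := by
  have := intervalIntegral.norm_integral_le_of_norm_le_const (a := 0) (b := x) (C := 1)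
    (f := fun t : ℝ => Real.sin (t / 2) * Real.sinc (t / 2)) (by
      intro t _
      rw [norm_mul]
      exact mul_le_one₀ (Real.abs_sin_le_one _) (norm_nonneg _) (Real.abs_sinc_le_one _))
  rw [Real.norm_eq_abs, sub_zero, abs_of_nonneg h0, one_mul] at this
  exact this.trans h1

lemma cin_formula (x : ℝ) (hx : 1 ≤ x) : Cin x - Real.log x =
    Cin 1 - (Real.sin x / x - Real.sin 1) - ∫ t in (1:ℝ)..x, Real.sin t / t ^ 2 := by
  have hpos : ∀ t ∈ Set.uIcc 1 x, t ≠ 0 := by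
    intro t ht
    rw [Set.uIcc_of_le hx] at ht
    have := ht.1
    linarith
  have hadd := intervalIntegral.integral_add_adjacent_intervals
    (cin_integrand_cont.intervalIntegrable (μ := MeasureTheory.volume) 0 1)
    (cin_integrand_cont.intervalIntegrable (μ := MeasureTheory.volume) 1 x)
  have hi1 : IntervalIntegrable (fun t : ℝ => 1 / t) MeasureTheory.volume 1 x :=
    ContinuousOn.intervalIntegrable (continuousOn_const.div continuousOn_id hpos)
  have hi2 : IntervalIntegrable (fun t : ℝ => Real.sin t / t ^ 2) MeasureTheory.volume 1 x :=
    ContinuousOn.intervalIntegrable ((by fun_prop : ContinuousOn Real.sin _).div (by fun_prop)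
      (fun t ht => pow_ne_zero 2 (hpos t ht)))
  have hi3 : IntervalIntegrable (fun t : ℝ => Real.cos t / t) MeasureTheory.volume 1 x :=
    ContinuousOn.intervalIntegrable ((by fun_prop : ContinuousOn Real.cos _).div (by fun_prop) hpos)
  have hftc : ∫ t in (1:ℝ)..x, (Real.cos t / t - Real.sin t / t ^ 2) =
      Real.sin x / x - Real.sin 1 / 1 := by
    apply intervalIntegral.integral_eq_sub_of_hasDerivAt (f := fun t => Real.sin t / t)
    · intro t ht
      have := (Real.hasDerivAt_sin t).div (hasDerivAt_id t) (hpos t ht)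
      refine this.congr_deriv ?_
      have := hpos t ht
      simp only [id_eq]
      field_simp
    · exact hi3.sub hi2
  rw [intervalIntegral.integral_sub hi3 hi2, div_one] at hftc
  have hc : ∫ t in (1:ℝ)..x, Real.sin (t / 2) * Real.sinc (t / 2) =
      ∫ t in (1:ℝ)..x, (1 / t - Real.cos t / t) := by
    apply intervalIntegral.integral_congr
    intro t ht
    simp only
    rw [cin_integrand_eq t (hpos t ht)]
    ring
  rw [intervalIntegral.integral_sub hi1 hi3, integral_one_div_of_pos one_pos (by linarith), div_one] at hc
  unfold Cin
  linarith

lemma cin_tendsto : ∃ c : ℝ, Tendsto (fun x => Cin x - Real.log x) atTop (nhds c) := by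
  have hint : MeasureTheory.IntegrableOn (fun t : ℝ => Real.sin t / t ^ 2) (Set.Ioi 1) := by
    have h := integrableOn_Ioi_rpow_of_lt (show (-2:ℝ) < -1 by norm_num) one_pos
    refine MeasureTheory.Integrable.mono' h ?_ ?_
    · exact Measurable.aestronglyMeasurable (by fun_prop)
    · refine (MeasureTheory.ae_restrict_iff' measurableSet_Ioi).2 (Eventually.of_forall fun t ht => ?_)
      have ht0 : (0:ℝ) < t := lt_trans one_pos ht
      rw [Real.rpow_neg ht0.le, Real.rpow_two, norm_div, div_eq_mul_inv, norm_pow, Real.norm_of_nonneg ht0.le]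
      have := Real.abs_sin_le_one t
      rw [Real.norm_eq_abs]
      have h3 : 0 ≤ (t ^ 2)⁻¹ := by positivity
      nlinarith
  have h1 := MeasureTheory.intervalIntegral_tendsto_integral_Ioi 1 hint tendsto_id
  have h2 : Tendsto (fun x : ℝ => Real.sin x / x) atTop (nhds 0) := by
    refine squeeze_zero_norm' ?_ tendsto_inv_atTop_zero
    filter_upwards [eventually_gt_atTop 0] with x hx
    rw [norm_div, Real.norm_eq_abs, Real.norm_of_nonneg hx.le, div_eq_mul_inv]
    have h3 : 0 ≤ x⁻¹ := by positivity
    nlinarith [Real.abs_sin_le_one x]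
  refine ⟨_, (((h2.sub_const (Real.sin 1)).const_sub (Cin 1)).sub h1).congr' ?_⟩
  filter_upwards [eventually_ge_atTop 1] with x hx
  rw [cin_formula x hx]
  rfl

lemma cin_bdd : ∃ C : ℝ, 1 ≤ C ∧ ∀ x, 1 ≤ x → |Cin x - Real.log x| ≤ C := by
  obtain ⟨c, hc⟩ := cin_tendsto
  have h1 : ∀ᶠ x in atTop, |Cin x - Real.log x| ≤ |c| + 1 := by
    have := hc.abs.eventually (eventually_le_nhds (lt_add_one |c|))
    exact this
  obtain ⟨X, hX⟩ := eventually_atTop.1 h1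
  have hcont : ContinuousOn (fun x => Cin x - Real.log x) (Set.Icc 1 X) :=
    cin_cont.continuousOn.sub (ContinuousOn.log continuousOn_id (fun x hx => by
      have := hx.1
      linarith))
  obtain ⟨B, hB⟩ := isCompact_Icc.exists_bound_of_continuousOn hcont
  refine ⟨max (|c| + 1) B, le_max_of_le_left (by linarith [abs_nonneg c]), fun x hx => ?_⟩
  rcases le_total X x with h | h
  · exact le_max_of_le_left (hX x h)
  · exact le_max_of_le_right (hB x ⟨hx, h⟩)

lemma cin_scale (b T : ℝ) : ∫ q in (0:ℝ)..T, (1 - Real.cos (b * q)) / q = Cin (b * T) := by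
  have h := intervalIntegral.smul_integral_comp_mul_left (a := 0) (b := T)
    (fun t : ℝ => Real.sin (t / 2) * Real.sinc (t / 2)) b
  rw [mul_zero] at h
  unfold Cin
  rw [← h, smul_eq_mul, ← intervalIntegral.integral_const_mul]
  apply intervalIntegral.integral_congr
  intro q _
  simp only
  rcases eq_or_ne b 0 with rfl | hb
  · simp
  rcases eq_or_ne q 0 with rfl | hq
  · simp
  rw [cin_integrand_eq _ (mul_ne_zero hb hq)]
  field_simp
/-- The integrand `(sin q - q cos q)/q²`. -/
def jone (q : ℝ) : ℝ := (Real.sin q - q * Real.cos q) / q ^ 2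

lemma jone_bound (q : ℝ) (hq : 0 ≤ q) : |jone q| ≤ 1 := by
  have h := norm_image_sub_le_of_norm_deriv_le_segment' (a := 0) (b := q) (C := q)
    (f := fun x => Real.sin x - x * Real.cos x) (f' := fun x => x * Real.sin x) (by
      intro x _
      apply HasDerivAt.hasDerivWithinAt
      have := (Real.hasDerivAt_sin x).sub ((hasDerivAt_id x).mul (Real.hasDerivAt_cos x))
      refine this.congr_deriv ?_
      simp only [id_eq]
      ring) (by
      intro x hx
      rw [norm_mul, Real.norm_of_nonneg hx.1, Real.norm_eq_abs]
      nlinarith [Real.abs_sin_le_one x, hx.1, hx.2, abs_nonneg (Real.sin x)]) q ⟨hq, le_rfl⟩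
  simp only [Real.sin_zero, zero_mul, sub_zero, Real.norm_eq_abs] at h
  unfold jone
  rw [abs_div, abs_of_nonneg (sq_nonneg q)]
  apply div_le_one_of_le₀ _ (sq_nonneg q)
  rw [sq]; exact h

lemma jone_meas : Measurable jone := by unfold jone; fun_prop

lemma inner_formula (a T : ℝ) (hT : 0 < T) :
    ∫ q in (0:ℝ)..T, jone q * Real.cos (a * q) =
      1 - Real.sinc T * Real.cos (a * T) - a * ((Cin ((1 + a) * T) - Cin ((1 - a) * T)) / 2) := by
  have hsc : Continuous (fun q => Real.sinc q * Real.sin (a * q)) :=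
    Real.continuous_sinc.mul (by fun_prop)
  have hj : IntervalIntegrable (fun q => jone q * Real.cos (a * q)) MeasureTheory.volume 0 T := by
    refine IntervalIntegrable.mono_fun' (g := fun _ => (1:ℝ)) intervalIntegrable_const ?_ ?_
    · exact (jone_meas.mul (by fun_prop)).aestronglyMeasurable
    · refine (MeasureTheory.ae_restrict_iff' measurableSet_uIoc).2 (Eventually.of_forall fun q hq => ?_)
      rw [Set.uIoc_of_le hT.le] at hq
      beta_reduce
      rw [norm_mul]
      exact mul_le_one₀ (jone_bound q hq.1.le) (norm_nonneg _) (Real.abs_cos_le_one _)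
  have hsi : IntervalIntegrable (fun q => a * (Real.sinc q * Real.sin (a * q)))
    MeasureTheory.volume 0 T := (hsc.const_mul a |>.intervalIntegrable _ _)
  have hftc : ∫ q in (0:ℝ)..T, (jone q * Real.cos (a * q) + a * (Real.sinc q * Real.sin (a * q))) =
      -(Real.sinc T * Real.cos (a * T)) - -(Real.sinc 0 * Real.cos (a * 0)) := by
    apply intervalIntegral.integral_eq_sub_of_hasDerivAt_of_le hT.le
      (f := fun q => -(Real.sinc q * Real.cos (a * q)))
    · exact ((Real.continuous_sinc.mul (by fun_prop)).neg).continuousOn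
    · intro q hq
      have hq0 : q ≠ 0 := hq.1.ne'
      have h1 : HasDerivAt Real.sinc (-jone q) q := by
        have := (Real.hasDerivAt_sin q).div (hasDerivAt_id q) hq0
        refine (this.congr_of_eventuallyEq ?_).congr_deriv ?_
        · filter_upwards [isOpen_ne.mem_nhds hq0] with x hx
          rw [Real.sinc_of_ne_zero hx]; rfl
        · unfold jone
          simp only [id]
          field_simp
          ring
      have h2 : HasDerivAt (fun q => Real.cos (a * q)) (-Real.sin (a * q) * a) q := by
        have := ((hasDerivAt_id q).const_mul a).cos
        simpa using this
      refine (h1.mul h2).neg.congr_deriv ?_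
      ring
    · exact hj.add hsi
  rw [intervalIntegral.integral_add hj hsi, intervalIntegral.integral_const_mul] at hftc
  have hii : ∀ b : ℝ, IntervalIntegrable (fun q => (1 - Real.cos (b * q)) / q)
      MeasureTheory.volume 0 T := by
    intro b
    have : (fun q : ℝ => (1 - Real.cos (b * q)) / q) =
        fun q => b * (Real.sin (b * q / 2) * Real.sinc (b * q / 2)) := by
      funext q
      rcases eq_or_ne b 0 with rfl | hb
      · simp
      rcases eq_or_ne q 0 with rfl | hq
      · simp
      rw [cin_integrand_eq _ (mul_ne_zero hb hq)]
      field_simp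
    rw [this]
    exact ((cin_integrand_cont.comp (by fun_prop : Continuous fun q : ℝ => b * q)).const_mul b).intervalIntegrable _ _
  have hS : ∫ q in (0:ℝ)..T, Real.sinc q * Real.sin (a * q) =
      (Cin ((1 + a) * T) - Cin ((1 - a) * T)) / 2 := by
    rw [← cin_scale, ← cin_scale, ← intervalIntegral.integral_sub (hii _) (hii _),
      ← intervalIntegral.integral_div]
    apply intervalIntegral.integral_congr
    intro q _
    simp only
    rcases eq_or_ne q 0 with rfl | hq
    · simp
    rw [Real.sinc_of_ne_zero hq, add_mul, sub_mul, one_mul, Real.cos_add, Real.cos_sub]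
    field_simp
    ring
  rw [hS] at hftc
  simp at hftc
  linarith

lemma fubini_step (l T : ℝ) (hT : 0 < T) :
    ∫ q in (0:ℝ)..T, jone q * J0 (l * q) =
      1 - Real.sinc T * J0 (l * T) - (1 / Real.pi) *
        ∫ θ in (0:ℝ)..Real.pi, l * Real.cos θ * Cin ((1 + l * Real.cos θ) * T) := by
  have hpi := Real.pi_pos
  have e1 : ∫ q in (0:ℝ)..T, jone q * J0 (l * q) = (1 / Real.pi) *
      ∫ q in (0:ℝ)..T, ∫ θ in (0:ℝ)..Real.pi, jone q * Real.cos (l * Real.cos θ * q) := by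
    rw [← intervalIntegral.integral_const_mul]
    apply intervalIntegral.integral_congr
    intro q _
    simp only
    rw [intervalIntegral.integral_const_mul, J0]
    rw [intervalIntegral.integral_congr (g := fun θ => Real.cos (l * Real.cos θ * q))]
    · ring
    · intro θ _
      simp only
      ring_nf
  rw [e1, MeasureTheory.intervalIntegral_intervalIntegral_swap]
  swap
  · rw [Set.uIoc_of_le hT.le, Set.uIoc_of_le hpi.le]
    refine MeasureTheory.Measure.integrableOn_of_bounded (M := 1) ?_ ?_ ?_
    · rw [MeasureTheory.Measure.volume_eq_prod, MeasureTheory.Measure.prod_prod]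
      simp [ENNReal.mul_eq_top]
    · exact ((jone_meas.comp measurable_fst).mul (by fun_prop)).aestronglyMeasurable
    · refine (MeasureTheory.ae_restrict_iff' (measurableSet_Ioc.prod measurableSet_Ioc)).2
        (Eventually.of_forall fun p hp => ?_)
      simp only [Function.uncurry]
      rw [norm_mul]
      exact mul_le_one₀ (jone_bound _ hp.1.1.le) (norm_nonneg _) (Real.abs_cos_le_one _)
  simp_rw [inner_formula _ T hT]
  have hcc : ∀ f : ℝ → ℝ, Continuous f → IntervalIntegrable f MeasureTheory.volume 0 Real.pi :=
    fun f hf => hf.intervalIntegrable _ _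
  have hc1 : Continuous fun θ : ℝ => l * Real.cos θ * Cin ((1 + l * Real.cos θ) * T) :=
    Continuous.mul (by fun_prop) (cin_cont.comp (by fun_prop))
  have hc2 : Continuous fun θ : ℝ => l * Real.cos θ * Cin ((1 - l * Real.cos θ) * T) :=
    Continuous.mul (by fun_prop) (cin_cont.comp (by fun_prop))
  have e2 : ∀ θ : ℝ, 1 - Real.sinc T * Real.cos (l * Real.cos θ * T) - l * Real.cos θ *
      ((Cin ((1 + l * Real.cos θ) * T) - Cin ((1 - l * Real.cos θ) * T)) / 2) =
      (1 - Real.sinc T * Real.cos (l * T * Real.cos θ)) -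
      ((1 / 2) * (l * Real.cos θ * Cin ((1 + l * Real.cos θ) * T)) -
        (1 / 2) * (l * Real.cos θ * Cin ((1 - l * Real.cos θ) * T))) := by
    intro θ
    rw [mul_right_comm l T]
    ring
  simp_rw [e2]
  rw [intervalIntegral.integral_sub (hcc _ (by fun_prop)) ((hcc _ (hc1.const_mul _)).sub (hcc _ (hc2.const_mul _))),
    intervalIntegral.integral_sub (hcc _ (hc1.const_mul _)) (hcc _ (hc2.const_mul _)),
    intervalIntegral.integral_sub (hcc _ (by fun_prop)) (hcc _ (by fun_prop)),
    intervalIntegral.integral_const_mul, intervalIntegral.integral_const_mul,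
    intervalIntegral.integral_const_mul]
  have hs := intervalIntegral.integral_comp_sub_left (a := 0) (b := Real.pi)
    (fun θ => l * Real.cos θ * Cin ((1 - l * Real.cos θ) * T)) Real.pi
  simp only [Real.cos_pi_sub, mul_neg, sub_neg_eq_add, neg_mul, sub_self, sub_zero,
    intervalIntegral.integral_neg] at hs
  rw [← hs, J0]
  simp only [intervalIntegral.integral_const, sub_zero, smul_eq_mul, mul_one]
  field_simp
  ring

lemma cos_ne_ae (l : ℝ) : ∀ᵐ θ : ℝ, θ ∈ Set.uIoc 0 Real.pi → 1 + l * Real.cos θ ≠ 0 := by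
  have h : {θ : ℝ | θ ∈ Set.Ioc 0 Real.pi ∧ 1 + l * Real.cos θ = 0}.Subsingleton := by
    rintro a ⟨ha, ha'⟩ b ⟨hb, hb'⟩
    have hl : l ≠ 0 := by rintro rfl; norm_num at ha'
    apply Real.injOn_cos ⟨ha.1.le, ha.2⟩ ⟨hb.1.le, hb.2⟩
    apply mul_left_cancel₀ hl
    linarith
  have := h.measure_zero MeasureTheory.volume
  rw [MeasureTheory.ae_iff, Set.uIoc_of_le Real.pi_pos.le]
  simpa [and_assoc] using this

lemma main_limit (l : ℝ) : Tendsto (fun T : ℝ =>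
      ∫ θ in (0:ℝ)..Real.pi, l * Real.cos θ * Cin ((1 + l * Real.cos θ) * T)) atTop
      (nhds (∫ θ in (0:ℝ)..Real.pi, l * Real.cos θ * Real.log |1 + l * Real.cos θ|)) := by
  obtain ⟨c, hc⟩ := cin_tendsto
  obtain ⟨C, hC1, hC⟩ := cin_bdd
  have hzero : ∀ k : ℝ, ∫ θ in (0:ℝ)..Real.pi, l * Real.cos θ * k = 0 := by
    intro k
    rw [intervalIntegral.integral_mul_const, intervalIntegral.integral_const_mul]
    simp
  have hlog : IntervalIntegrable (fun θ : ℝ => Real.log |1 + l * Real.cos θ|)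
      MeasureTheory.volume 0 Real.pi := by
    apply MeromorphicOn.intervalIntegrable_log_norm (f := fun θ : ℝ => 1 + l * Real.cos θ)
    intro x _
    apply AnalyticAt.meromorphicAt
    exact analyticAt_const.add (analyticAt_const.mul Real.analyticAt_cos)
  have hcos : ∀ k : ℝ, IntervalIntegrable (fun θ : ℝ => l * Real.cos θ * k)
      MeasureTheory.volume 0 Real.pi := fun k => Continuous.intervalIntegrable (by fun_prop) _ _
  have hlim : Tendsto (fun T : ℝ => ∫ θ in (0:ℝ)..Real.pi, l * Real.cos θ *
      (Cin ((1 + l * Real.cos θ) * T) - Real.log T)) atTop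
      (nhds (∫ θ in (0:ℝ)..Real.pi, l * Real.cos θ * (Real.log |1 + l * Real.cos θ| + c))) := by
    apply intervalIntegral.tendsto_integral_filter_of_dominated_convergence
      (fun θ => |l| * (C + |Real.log (|1 + l * Real.cos θ|)|))
    · refine Eventually.of_forall fun T => Continuous.aestronglyMeasurable ?_
      exact Continuous.mul (by fun_prop) ((cin_cont.comp (by fun_prop)).sub continuous_const)
    · filter_upwards [eventually_ge_atTop 1] with T hT
      filter_upwards [cos_ne_ae l] with θ hθ hθm
      have hy : 0 < |1 + l * Real.cos θ| := abs_pos.2 (hθ hθm)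
      rw [norm_mul, norm_mul, Real.norm_eq_abs, Real.norm_eq_abs, Real.norm_eq_abs]
      have hT0 : 0 < T := by linarith
      have hTl : 0 ≤ Real.log T := Real.log_nonneg hT
      have h1 : |Cin ((1 + l * Real.cos θ) * T) - Real.log T| ≤ C + |Real.log (|1 + l * Real.cos θ|)| := by
        rw [← cin_abs, abs_mul, abs_of_pos hT0]
        set y := |1 + l * Real.cos θ|
        have hlm : Real.log (y * T) = Real.log y + Real.log T := Real.log_mul hy.ne' hT0.ne'
        rcases le_total 1 (y * T) with h | h
        · have := hC _ h
          have e : Cin (y * T) - Real.log T = (Cin (y * T) - Real.log (y * T)) + Real.log y := by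
            rw [hlm]; ring
          rw [e]
          exact (abs_add_le _ _).trans (by linarith)
        · have h2 := cin_small _ (by positivity) h
          have h3 : Real.log (y * T) ≤ 0 := Real.log_nonpos (by positivity) h
          have h4 : |Real.log T| ≤ |Real.log y| := by
            rw [abs_of_nonneg hTl]
            linarith [neg_abs_le (Real.log y)]
          exact (abs_sub _ _).trans (by linarith)
      have h2 : |l| * |Real.cos θ| ≤ |l| := mul_le_of_le_one_right (abs_nonneg l) (Real.abs_cos_le_one θ)
      exact mul_le_mul h2 h1 (abs_nonneg _) (abs_nonneg _)
    · exact (intervalIntegrable_const.add hlog.abs).const_mul _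
    · filter_upwards [cos_ne_ae l] with θ hθ hθm
      have hy : 0 < |1 + l * Real.cos θ| := abs_pos.2 (hθ hθm)
      apply Tendsto.const_mul
      have h1 : Tendsto (fun T : ℝ => |1 + l * Real.cos θ| * T) atTop atTop :=
        tendsto_id.const_mul_atTop hy
      have h2 := (hc.comp h1).const_add (Real.log |1 + l * Real.cos θ|)
      refine h2.congr' ?_
      filter_upwards [eventually_gt_atTop 0] with T hT
      simp only [Function.comp]
      rw [← cin_abs ((1 + l * Real.cos θ) * T), abs_mul, abs_of_pos hT, Real.log_mul hy.ne' hT.ne']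
      ring
  have e1 : ∫ θ in (0:ℝ)..Real.pi, l * Real.cos θ * (Real.log |1 + l * Real.cos θ| + c) =
      ∫ θ in (0:ℝ)..Real.pi, l * Real.cos θ * Real.log |1 + l * Real.cos θ| := by
    simp_rw [mul_add (l * Real.cos _)]
    rw [intervalIntegral.integral_add (hlog.continuousOn_mul (by fun_prop)) (hcos c), hzero, add_zero]
  rw [e1] at hlim
  refine hlim.congr fun T => ?_
  simp_rw [mul_sub (l * Real.cos _)]
  rw [intervalIntegral.integral_sub _ (hcos _), hzero, sub_zero]
  exact Continuous.intervalIntegrable (Continuous.mul (by fun_prop) (cin_cont.comp (by fun_prop))) _ _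

lemma J0_bound (z : ℝ) : |J0 z| ≤ 1 := by
  have hpi := Real.pi_pos
  have := intervalIntegral.norm_integral_le_of_norm_le_const (a := 0) (b := Real.pi) (C := 1)
    (f := fun θ => Real.cos (z * Real.cos θ)) (fun θ _ => Real.abs_cos_le_one _)
  rw [Real.norm_eq_abs, sub_zero, abs_of_pos hpi, one_mul] at this
  rw [J0, abs_mul, abs_of_pos (by positivity), one_div, inv_mul_le_one₀ hpi]
  exact this

/-- the improper integral `∫₀^∞ ((sin q − q cos q)/q²)·J₀(λq) dq` equals
`√(1 − λ²)` if `|λ| < 1` and `0` if `|λ| ≥ 1`. -/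
theorem bessel_improper_integral (l : ℝ) :
    Tendsto (fun T : ℝ => ∫ q in (0:ℝ)..T, ((Real.sin q - q * Real.cos q) / q ^ 2) * J0 (l * q))
      atTop (nhds (if |l| < 1 then Real.sqrt (1 - l ^ 2) else 0)) := by
  have h0 : Tendsto (fun T : ℝ => Real.sinc T * J0 (l * T)) atTop (nhds 0) := by
    refine squeeze_zero_norm' ?_ tendsto_inv_atTop_zero
    filter_upwards [eventually_gt_atTop 0] with x hx
    rw [norm_mul, Real.sinc_of_ne_zero hx.ne', norm_div, Real.norm_eq_abs, Real.norm_of_nonneg hx.le,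
      div_eq_mul_inv]
    have h3 : 0 ≤ x⁻¹ := by positivity
    have h4 : |Real.sin x| * x⁻¹ ≤ x⁻¹ := mul_le_of_le_one_left h3 (Real.abs_sin_le_one x)
    exact (mul_le_of_le_one_right (by positivity) (J0_bound _)).trans h4
  have h := (h0.const_sub 1).sub ((main_limit l).const_mul (1 / Real.pi))
  rw [sub_zero, log_cos_int] at h
  refine h.congr' ?_
  filter_upwards [eventually_gt_atTop 0] with T hT
  exact (fubini_step l T hT).symm

end
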